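/- Let α, δ ∈ ℂ with α ≠ 0 and α² ≠ 1. Then the biquadratic polynomial h(x,y) := (α/(1−α²))·(x² + y²) − ((1+α²)/(1−α²))·xy + δ(1−α²)/(4α) satisfies δ_y(h) = x² − δ and δ_x(h) = y² − δ; moreover i₂(h) = (1 + 10α² + α⁴)/(1−α²)² and i₃(h) = α²(1+α²)/(1−α²)³. -/

import Mathlib

open MvPolynomial

/-- `δ_{x_i}(h) = h_{x_i}^2 - 2 h h_{x_i x_i}` for a polynomial of two variables
(`x` is the variable indexed `0`, `y` the one indexed `1`). -/
noncomputable def ds (i : Fin 2) (h : MvPolynomial (Fin 2) ℂ) : MvPolynomial (Fin 2) ℂ :=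
  (pderiv i h) ^ 2 - 2 * h * pderiv i (pderiv i h)

/-- The coefficient of `x^i y^j` in `h(x,y)`. -/
noncomputable def cf (h : MvPolynomial (Fin 2) ℂ) (i j : ℕ) : ℂ :=
  h.coeff (Finsupp.single (0 : Fin 2) i + Finsupp.single (1 : Fin 2) j)

/-- `i₂(h) = 8 h₀₀ h₂₂ - 4 h₀₁ h₂₁ - 4 h₁₀ h₁₂ + 8 h₀₂ h₂₀ + h₁₁²`. -/
noncomputable def inv2 (h : MvPolynomial (Fin 2) ℂ) : ℂ :=
  8 * cf h 0 0 * cf h 2 2 - 4 * cf h 0 1 * cf h 2 1 - 4 * cf h 1 0 * cf h 1 2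
    + 8 * cf h 0 2 * cf h 2 0 + (cf h 1 1) ^ 2

/-- `i₃(h) = det [[h₂₂, h₂₁, h₂₀], [h₁₂, h₁₁, h₁₀], [h₀₂, h₀₁, h₀₀]]`. -/
noncomputable def inv3 (h : MvPolynomial (Fin 2) ℂ) : ℂ :=
  Matrix.det !![cf h 2 2, cf h 2 1, cf h 2 0;
                cf h 1 2, cf h 1 1, cf h 1 0;
                cf h 0 2, cf h 0 1, cf h 0 0]

/-- `δ_{x_i}` of a symmetric biquadratic, for the two variables `x_i` and `x_j`. -/
theorem ds_symmetric_biquadratic (a b d : ℂ) {i j : Fin 2} (hij : i ≠ j) :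
    ds i (C a * (X i ^ 2 + X j ^ 2) - C b * (X i * X j) + C d) =
      C (b ^ 2 - 4 * a ^ 2) * X j ^ 2 - C (4 * a * d) := by
  have hC2 : (C 2 : MvPolynomial (Fin 2) ℂ) = 2 := map_ofNat C 2
  have hC4 : (C 4 : MvPolynomial (Fin 2) ℂ) = 4 := map_ofNat C 4
  have h1 : pderiv i (C a * (X i ^ 2 + X j ^ 2) - C b * (X i * X j) + C d) =
      C (2 * a) * X i - C b * X j := by
    simp [pderiv_X_of_ne hij.symm, Derivation.leibniz, Derivation.leibniz_pow, hC2]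
    ring
  have h2 : pderiv i (C (2 * a) * X i - C b * X j : MvPolynomial (Fin 2) ℂ) = C (2 * a) := by
    simp only [map_sub, pderiv_C_mul, pderiv_X_self, pderiv_X_of_ne hij.symm]
    ring
  rw [ds, h1, h2]
  simp only [map_sub, map_mul, map_pow, hC2, hC4]
  ring

/-- The coefficients of a symmetric biquadratic. -/
theorem cf_symmetric_biquadratic (a b d : ℂ) (i j : ℕ) :
    cf (C a * (X 0 ^ 2 + X 1 ^ 2) - C b * (X 0 * X 1) + C d) i j =
      a * ((if i = 2 ∧ j = 0 then 1 else 0) + (if i = 0 ∧ j = 2 then 1 else 0))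
        - b * (if i = 1 ∧ j = 1 then 1 else 0) + (if i = 0 ∧ j = 0 then d else 0) := by
  have hX : (X 0 * X 1 : MvPolynomial (Fin 2) ℂ) =
      monomial (Finsupp.single 0 1 + Finsupp.single 1 1) 1 := by
    simp [X, monomial_mul]
  simp [cf, hX, X_pow_eq_monomial, coeff_C_mul, coeff_monomial, coeff_C, Finsupp.ext_iff,
    Fin.forall_fin_two, eq_comm]

/-- The biquadratic `h(x,y) = (α/(1-α²))(x²+y²) - ((1+α²)/(1-α²))xy + δ(1-α²)/(4α)` has
discriminants `δ_y(h) = x² - δ`, `δ_x(h) = y² - δ` and invariants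
`i₂ = (1+10α²+α⁴)/(1-α²)²`, `i₃ = α²(1+α²)/(1-α²)³`. -/
theorem statement12 (α δ : ℂ) (hα : α ≠ 0) (hα1 : α ^ 2 ≠ 1) :
    ds 1 (C (α / (1 - α ^ 2)) * (X 0 ^ 2 + X 1 ^ 2)
        - C ((1 + α ^ 2) / (1 - α ^ 2)) * (X 0 * X 1) + C (δ * (1 - α ^ 2) / (4 * α))) =
      X 0 ^ 2 - C δ ∧
    ds 0 (C (α / (1 - α ^ 2)) * (X 0 ^ 2 + X 1 ^ 2)
        - C ((1 + α ^ 2) / (1 - α ^ 2)) * (X 0 * X 1) + C (δ * (1 - α ^ 2) / (4 * α))) =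
      X 1 ^ 2 - C δ ∧
    inv2 (C (α / (1 - α ^ 2)) * (X 0 ^ 2 + X 1 ^ 2)
        - C ((1 + α ^ 2) / (1 - α ^ 2)) * (X 0 * X 1) + C (δ * (1 - α ^ 2) / (4 * α))) =
      (1 + 10 * α ^ 2 + α ^ 4) / (1 - α ^ 2) ^ 2 ∧
    inv3 (C (α / (1 - α ^ 2)) * (X 0 ^ 2 + X 1 ^ 2)
        - C ((1 + α ^ 2) / (1 - α ^ 2)) * (X 0 * X 1) + C (δ * (1 - α ^ 2) / (4 * α))) =
      α ^ 2 * (1 + α ^ 2) / (1 - α ^ 2) ^ 3 := by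
  have h1 : 1 - α ^ 2 ≠ 0 := sub_ne_zero.mpr hα1.symm
  have hlead : ((1 + α ^ 2) / (1 - α ^ 2)) ^ 2 - 4 * (α / (1 - α ^ 2)) ^ 2 = 1 := by
    field_simp
    ring
  have hconst : 4 * (α / (1 - α ^ 2)) * (δ * (1 - α ^ 2) / (4 * α)) = δ := by
    field_simp
  refine ⟨?_, ?_, ?_, ?_⟩
  · rw [add_comm (X 0 ^ 2), mul_comm (X 0), ds_symmetric_biquadratic _ _ _ one_ne_zero,
      hlead, hconst, C_1, one_mul]
  · rw [ds_symmetric_biquadratic _ _ _ zero_ne_one, hlead, hconst, C_1, one_mul]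
  · simp only [inv2, cf_symmetric_biquadratic]
    norm_num
    field_simp
    ring
  · simp [inv3, cf_symmetric_biquadratic, Matrix.det_fin_three]
    field_simp
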